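/- Let (Ω, μ) be a probability space and R : Ω → ℝ a nonnegative integrable random variable that is not almost-everywhere constant, with ∫ R dμ > 0. Let Π : ℝ → ℝ be strictly concave on ℝ, strictly monotone increasing, with Π(0) = 0, let r ≥ 0 and N ≥ 1 a natural number. Then the acceptance set S := {P ∈ ℝ : P ≥ 0 and (1/N)·∫ Π(R(ω) − P) dμ(ω) − r·P ≥ 0} contains 0, and if P̄ is a greatest element of S then P̄ < ∫ R dμ; consequently the MEV capture ratio χ := P̄ / (∫ R dμ) satisfies χ < 1. -/

import Mathlib

open MeasureTheory

/-- A monotone concave function on `ℝ` vanishing at `0` has linear growth from above. -/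
lemma ConcaveOn.le_mul_abs_add_one {f : ℝ → ℝ} (hf : ConcaveOn ℝ Set.univ f)
    (hmono : Monotone f) (h0 : f 0 = 0) (x : ℝ) : f x ≤ f 1 * (|x| + 1) := by
  have h1 : 0 ≤ f 1 := h0 ▸ hmono zero_le_one
  rcases le_total x 1 with hx | hx
  · nlinarith [hmono hx, abs_nonneg x]
  · have hx0 : 0 < x := by linarith
    have h := hf.2 (Set.mem_univ x) (Set.mem_univ 0) (inv_nonneg.2 hx0.le)
      (sub_nonneg.2 (inv_le_one_of_one_le₀ hx)) (add_sub_cancel _ _)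
    simp only [smul_eq_mul, h0, mul_zero, add_zero, inv_mul_cancel₀ hx0.ne'] at h
    rw [inv_mul_le_iff₀ hx0] at h
    rw [abs_of_pos hx0]
    nlinarith

/-- A monotone concave function of an integrable variable that is bounded below is integrable. -/
lemma ConcaveOn.integrable_comp {Ω : Type*} [MeasurableSpace Ω] {μ : Measure Ω}
    [IsFiniteMeasure μ] {f : ℝ → ℝ} (hf : ConcaveOn ℝ Set.univ f) (hmono : Monotone f)
    (h0 : f 0 = 0) {X : Ω → ℝ} (hX : Integrable X μ) {a : ℝ} (ha : ∀ ω, a ≤ X ω) :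
    Integrable (fun ω => f (X ω)) μ := by
  have hcont : Continuous f := continuousOn_univ.1 (hf.continuousOn isOpen_univ)
  refine Integrable.mono' (g := fun ω => |f a| + f 1 * (|X ω| + 1))
    ((integrable_const _).add ((hX.abs.add (integrable_const _)).const_mul _))
    (hcont.comp_aestronglyMeasurable hX.aestronglyMeasurable) (ae_of_all _ fun ω => ?_)
  have h1 : 0 ≤ f 1 * (|X ω| + 1) :=
    mul_nonneg (h0 ▸ hmono zero_le_one) (by positivity)
  rw [Real.norm_eq_abs, abs_le]
  constructor
  · linarith [hmono (ha ω), neg_abs_le (f a)]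
  · linarith [hf.le_mul_abs_add_one hmono h0 (X ω), abs_nonneg (f a)]

/-- With risk aversion (strictly concave, strictly increasing `Π`, `Π 0 = 0`) and
capital cost `r ≥ 0`, the acceptance set contains `0`, any greatest element `P̄`
satisfies `P̄ < ∫ R dμ`, and the MEV capture ratio is strictly below 1. -/
theorem stmt_2 {Ω : Type*} [MeasurableSpace Ω] (μ : Measure Ω) [IsProbabilityMeasure μ]
    (R : Ω → ℝ) (hRint : Integrable R μ) (hRnn : ∀ ω, 0 ≤ R ω)
    (hRnc : ¬ ∃ c : ℝ, R =ᵐ[μ] fun _ => c)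
    (hRpos : 0 < ∫ ω, R ω ∂μ)
    (Pi : ℝ → ℝ) (hPiConc : StrictConcaveOn ℝ Set.univ Pi)
    (hPiMono : StrictMono Pi) (hPi0 : Pi 0 = 0)
    (r : ℝ) (hr : 0 ≤ r) (N : ℕ) (hN : 1 ≤ N) :
    (0 : ℝ) ∈ {P : ℝ | 0 ≤ P ∧ (1 / (N : ℝ)) * (∫ ω, Pi (R ω - P) ∂μ) - r * P ≥ 0} ∧
    ∀ Pbar : ℝ,
      IsGreatest {P : ℝ | 0 ≤ P ∧ (1 / (N : ℝ)) * (∫ ω, Pi (R ω - P) ∂μ) - r * P ≥ 0} Pbar →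
      Pbar < ∫ ω, R ω ∂μ ∧ Pbar / (∫ ω, R ω ∂μ) < 1 := by
  have hint : ∀ P : ℝ, Integrable (fun ω => Pi (R ω - P)) μ := fun P =>
    hPiConc.concaveOn.integrable_comp hPiMono.monotone hPi0 (hRint.sub (integrable_const P))
      (a := -P) fun ω => by simp [hRnn ω]
  have hN0 : (0 : ℝ) < 1 / N := one_div_pos.2 (by exact_mod_cast hN)
  refine ⟨⟨le_rfl, ?_⟩, fun P hP => ?_⟩
  · have h : 0 ≤ ∫ ω, Pi (R ω - 0) ∂μ :=
      integral_nonneg fun ω =>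
        hPi0.ge.trans (hPiMono.monotone (by simpa using hRnn ω))
    rw [mul_zero, sub_zero]
    exact mul_nonneg hN0.le h
  · suffices h : P < ∫ ω, R ω ∂μ from ⟨h, (div_lt_one hRpos).2 h⟩
    by_contra! hle
    obtain ⟨hP0, hacc⟩ := hP.1
    set m := ∫ ω, R ω ∂μ with hm
    have hcont : ContinuousOn Pi Set.univ := hPiConc.concaveOn.continuousOn isOpen_univ
    have hjensen : ∫ ω, Pi (R ω - m) ∂μ < 0 := by
      have hmean : ∫ ω, (R ω - m) ∂μ = 0 := by
        rw [integral_sub hRint (integrable_const m)]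
        simp [hm]
      rcases hPiConc.ae_eq_const_or_lt_map_average hcont isClosed_univ
        (ae_of_all μ fun ω => Set.mem_univ (R ω - m)) (hRint.sub (integrable_const m))
        (hint m) with h | h
      · refine absurd ⟨m, ?_⟩ hRnc
        rw [average_eq_integral, hmean] at h
        filter_upwards [h] with ω hω
        exact sub_eq_zero.1 hω
      · rwa [average_eq_integral, average_eq_integral, hmean, hPi0] at h
    have hle' : ∫ ω, Pi (R ω - P) ∂μ ≤ ∫ ω, Pi (R ω - m) ∂μ :=
      integral_mono (hint P) (hint m) fun ω => hPiMono.monotone (by linarith)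
    have hneg := mul_neg_of_pos_of_neg hN0 (hle'.trans_lt hjensen)
    linarith [mul_nonneg hr hP0]
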